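/- Let F : ℂ → ℂ be a measurable function in the class 𝔇_{1,-}, i.e., for every a > 0 there is a constant C_a with |F(z)| ≤ C_a e^{|z|² − a|z|} for all z ∈ ℂ. If ∫_ℂ F(w) w^k conj(w)^{k'} e^{−|w|²} dλ(w) = 0 for all k, k' ∈ ℕ, then F = 0 almost everywhere on ℂ. -/

import Mathlib

open MeasureTheory Complex Filter

/-- A function belongs to the class `𝔇_{1,-}` if for every `a > 0` there is a
constant `C` with `|h z| ≤ C e^{|z|² - a|z|}` for all `z`. -/
def MemDOneMinus (h : ℂ → ℂ) : Prop :=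
  ∀ a : ℝ, 0 < a → ∃ C : ℝ, ∀ z : ℂ, ‖h z‖ ≤ C * Real.exp (‖z‖ ^ 2 - a * ‖z‖)

open scoped FourierTransform SchwartzMap ContDiff ComplexConjugate

/-- An integrable function with vanishing Fourier transform vanishes almost everywhere. -/
theorem ae_eq_zero_of_fourier_eq_zero {V : Type*} [NormedAddCommGroup V] [InnerProductSpace ℝ V]
    [FiniteDimensional ℝ V] [MeasurableSpace V] [BorelSpace V] {f : V → ℂ}
    (hf : Integrable f) (h : ∀ v, 𝓕 f v = 0) : f =ᵐ[volume] 0 := by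
  refine ae_eq_zero_of_integral_contDiff_smul_eq_zero hf.locallyIntegrable fun g hg hgs ↦ ?_
  let φ : 𝓢(V, ℂ) := (hgs.comp_left (g := ((↑) : ℝ → ℂ)) rfl).toSchwartzMap
    (ofRealCLM.contDiff.comp hg)
  let ψ : 𝓢(V, ℂ) := 𝓕⁻ φ
  have hψ : ∀ x, 𝓕 (ψ : V → ℂ) x = g x := fun x ↦ by
    rw [← SchwartzMap.fourier_coe, FourierTransform.fourier_fourierInv_eq]
    rfl
  have key := VectorFourier.integral_fourierIntegral_smul_eq_flip (L := innerₗ V)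
    Real.continuous_fourierChar continuous_inner (ψ.integrable (μ := volume)) hf
  rw [flip_innerₗ] at key
  change ∫ ξ, 𝓕 (ψ : V → ℂ) ξ • f ξ = ∫ x, ψ x • 𝓕 f x at key
  simpa [hψ, h] using key

theorem hasSum_pow_div_factorial (z : ℂ) :
    HasSum (fun n : ℕ ↦ z ^ n / n.factorial) (cexp z) := by
  rw [Complex.exp_eq_exp_ℂ]
  exact NormedSpace.expSeries_div_hasSum_exp z

/-- If all moments of a function decaying faster than every exponential vanish, then so do all
its exponential integrals. -/
theorem integral_cexp_mul_eq_zero_of_moments {G : ℂ → ℂ} (hG : AEStronglyMeasurable G)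
    (hint : ∀ c : ℝ, Integrable fun z : ℂ ↦ Real.exp (c * ‖z‖) * ‖G z‖)
    (hmom : ∀ k l : ℕ, ∫ z : ℂ, z ^ k * conj z ^ l * G z = 0) (α β : ℂ) :
    ∫ z : ℂ, cexp (α * z + β * conj z) * G z = 0 := by
  have hmono : ∀ k l : ℕ, Integrable fun z : ℂ ↦ z ^ k * conj z ^ l * G z := fun k l ↦ by
    refine ((hint 1).const_mul ((k + l).factorial : ℝ)).mono' (by fun_prop) (.of_forall fun z ↦ ?_)
    have h := Real.pow_div_factorial_le_exp ‖z‖ (norm_nonneg z) (k + l)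
    rw [div_le_iff₀' (by positivity)] at h
    simp only [norm_mul, norm_pow, RCLike.norm_conj, ← pow_add, one_mul, ← mul_assoc]
    gcongr
  have hterm : ∀ n : ℕ, ∫ z : ℂ, (α * z + β * conj z) ^ n / n.factorial * G z = 0 := fun n ↦ by
    have hexp : ∀ z : ℂ, (α * z + β * conj z) ^ n / n.factorial * G z =
        ∑ m ∈ Finset.range (n + 1), α ^ m * β ^ (n - m) * n.choose m / n.factorial *
          (z ^ m * conj z ^ (n - m) * G z) := fun z ↦ by
      rw [add_pow, Finset.sum_div, Finset.sum_mul]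
      refine Finset.sum_congr rfl fun m _ ↦ ?_
      ring
    simp_rw [hexp]
    rw [integral_finsetSum _ fun m _ ↦ (hmono m (n - m)).const_mul _]
    simp [integral_const_mul, hmom]
  have hbound : ∀ z : ℂ, HasSum
      (fun n : ℕ ↦ ((‖α‖ + ‖β‖) * ‖z‖) ^ n / n.factorial * ‖G z‖)
      (Real.exp ((‖α‖ + ‖β‖) * ‖z‖) * ‖G z‖) := fun z ↦ by
    rw [Real.exp_eq_exp_ℝ]
    exact (NormedSpace.expSeries_div_hasSum_exp ((‖α‖ + ‖β‖) * ‖z‖)).mul_right ‖G z‖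
  have hsum : HasSum (fun n : ℕ ↦ ∫ z : ℂ, (α * z + β * conj z) ^ n / n.factorial * G z)
      (∫ z : ℂ, cexp (α * z + β * conj z) * G z) := by
    refine hasSum_integral_of_dominated_convergence
      (fun n z ↦ ((‖α‖ + ‖β‖) * ‖z‖) ^ n / n.factorial * ‖G z‖)
      (fun n ↦ by fun_prop) (fun n ↦ .of_forall fun z ↦ ?_)
      (.of_forall fun z ↦ (hbound z).summable) ?_ (.of_forall fun z ↦ ?_)
    · have h : ‖α * z + β * conj z‖ ≤ (‖α‖ + ‖β‖) * ‖z‖ := by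
        refine (norm_add_le _ _).trans_eq ?_
        simp only [norm_mul, RCLike.norm_conj]
        ring
      simp only [norm_mul, norm_div, norm_pow, RCLike.norm_natCast]
      gcongr
    · simpa only [(hbound _).tsum_eq] using hint (‖α‖ + ‖β‖)
    · exact (hasSum_pow_div_factorial _).mul_right (G z)
  simp only [hterm] at hsum
  exact hsum.unique hasSum_zero

/-- A measurable function on `ℂ` which decays faster than every exponential and whose mixed
moments all vanish is zero almost everywhere. -/
theorem ae_eq_zero_of_moments {G : ℂ → ℂ} (hG : AEStronglyMeasurable G)
    (hint : ∀ c : ℝ, Integrable fun z : ℂ ↦ Real.exp (c * ‖z‖) * ‖G z‖)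
    (hmom : ∀ k l : ℕ, ∫ z : ℂ, z ^ k * conj z ^ l * G z = 0) : G =ᵐ[volume] 0 := by
  have hGint : Integrable G := (integrable_norm_iff hG).1 (by simpa using hint 0)
  refine ae_eq_zero_of_fourier_eq_zero hGint fun w ↦ ?_
  rw [Real.fourier_eq', ← integral_cexp_mul_eq_zero_of_moments hG hint hmom
    (-Real.pi * I * conj w) (-Real.pi * I * w)]
  congr! 4 with z
  apply Complex.ext
  · simp [Complex.inner]
  · simp [Complex.inner]
    ring

theorem exp_neg_three_mul_le {t : ℝ} (ht : 0 ≤ t) : Real.exp (-(3 * t)) ≤ (1 + t) ^ (-3 : ℝ) := by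
  rw [Real.exp_neg, Real.rpow_neg (by positivity)]
  gcongr
  rw [mul_comm, Real.exp_mul]
  gcongr
  linarith [Real.add_one_le_exp t]

theorem MemDOneMinus.integrable_exp_mul {F : ℂ → ℂ} (hF : MemDOneMinus F) (hFmeas : Measurable F)
    (c : ℝ) :
    Integrable fun z : ℂ ↦ Real.exp (c * ‖z‖) * ‖F z * (Real.exp (-‖z‖ ^ 2) : ℂ)‖ := by
  obtain ⟨C, hC⟩ := hF (|c| + 3) (by positivity)
  have hC0 : 0 ≤ C := nonneg_of_mul_nonneg_left ((norm_nonneg _).trans (hC 0)) (Real.exp_pos _)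
  refine ((integrable_one_add_norm (E := ℂ) (μ := volume) (r := 3)
    (by simp [Complex.finrank_real_complex]; norm_num)).const_mul C).mono'
    (by fun_prop) (.of_forall fun z ↦ ?_)
  rw [norm_mul, norm_norm, norm_mul, norm_real, Real.norm_of_nonneg (Real.exp_pos _).le,
    Real.norm_of_nonneg (Real.exp_pos _).le]
  calc Real.exp (c * ‖z‖) * (‖F z‖ * Real.exp (-‖z‖ ^ 2))
      ≤ Real.exp (|c| * ‖z‖) *
          (C * Real.exp (‖z‖ ^ 2 - (|c| + 3) * ‖z‖) * Real.exp (-‖z‖ ^ 2)) := by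
        gcongr
        · exact le_abs_self c
        · exact hC z
    _ = C * Real.exp (-(3 * ‖z‖)) := by
        rw [mul_assoc, ← Real.exp_add, mul_left_comm, ← Real.exp_add]
        ring_nf
    _ ≤ C * (1 + ‖z‖) ^ (-3 : ℝ) := by
        gcongr
        exact exp_neg_three_mul_le (norm_nonneg z)

theorem rank_zero_theorem
    (F : ℂ → ℂ) (hFmeas : Measurable F) (hF : MemDOneMinus F)
    (hmom : ∀ k k' : ℕ,
      ∫ w : ℂ, F w * w ^ k * ((starRingEnd ℂ) w) ^ k' *
        (Real.exp (-‖w‖ ^ 2) : ℂ) = 0) :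
    F =ᵐ[volume] 0 := by
  have hG : (fun z ↦ F z * (Real.exp (-‖z‖ ^ 2) : ℂ)) =ᵐ[volume] 0 := by
    refine ae_eq_zero_of_moments (by fun_prop) (hF.integrable_exp_mul hFmeas) fun k l ↦ ?_
    rw [← hmom k l]
    congr! 2 with z
    ring
  filter_upwards [hG] with z hz
  exact (mul_eq_zero.1 hz).resolve_right (ofReal_ne_zero.2 (Real.exp_ne_zero _))
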